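/- Let d' = dim_ℚ ker(A − I : ℚⁿ → ℚⁿ). Then there exists a finite abelian group H and a group isomorphism between the abelianization of Γ_A and ℤ^{1+d'} × H. (Geometrically: the first Betti number of the torus bundle M over S¹ obtained by suspension of A equals 1 + dim ker(A − I).) -/

import Mathlib

open Matrix

/-- The group `Γ_A` with underlying set `ℤⁿ × ℤ` and multiplication
`(x, y) · (x', y') = (x + A^y x', y + y')`. -/
@[ext]
structure Gamma (n : ℕ) (A : (Matrix (Fin n) (Fin n) ℤ)ˣ) where
  x : Fin n → ℤ
  y : ℤ

namespace Gamma

variable {n : ℕ} {A : (Matrix (Fin n) (Fin n) ℤ)ˣ}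

instance : Mul (Gamma n A) :=
  ⟨fun g g' =>
    ⟨g.x + ((A ^ g.y : (Matrix (Fin n) (Fin n) ℤ)ˣ) : Matrix (Fin n) (Fin n) ℤ).mulVec g'.x,
      g.y + g'.y⟩⟩

instance : One (Gamma n A) := ⟨⟨0, 0⟩⟩

instance : Inv (Gamma n A) :=
  ⟨fun g =>
    ⟨-((A ^ (-g.y) : (Matrix (Fin n) (Fin n) ℤ)ˣ) : Matrix (Fin n) (Fin n) ℤ).mulVec g.x, -g.y⟩⟩

theorem mul_x (g g' : Gamma n A) :
    (g * g').x =
      g.x + ((A ^ g.y : (Matrix (Fin n) (Fin n) ℤ)ˣ) : Matrix (Fin n) (Fin n) ℤ).mulVec g'.x :=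
  rfl

theorem mul_y (g g' : Gamma n A) : (g * g').y = g.y + g'.y := rfl

theorem one_x : (1 : Gamma n A).x = 0 := rfl

theorem one_y : (1 : Gamma n A).y = 0 := rfl

theorem inv_x (g : Gamma n A) :
    g⁻¹.x =
      -((A ^ (-g.y) : (Matrix (Fin n) (Fin n) ℤ)ˣ) : Matrix (Fin n) (Fin n) ℤ).mulVec g.x :=
  rfl

theorem inv_y (g : Gamma n A) : g⁻¹.y = -g.y := rfl

instance : Group (Gamma n A) where
  mul_assoc g g' g'' := by
    have hA : IsUnit (A : Matrix (Fin n) (Fin n) ℤ).det :=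
      (Matrix.isUnit_iff_isUnit_det _).mp A.isUnit
    ext
    · simp [mul_x, mul_y, Matrix.mulVec_add, ← Matrix.mulVec_mulVec, add_assoc,
        Matrix.zpow_add hA]
    · simp [mul_y, add_assoc]
  one_mul g := by
    ext
    · simp [mul_x, one_x, one_y, Matrix.one_mulVec]
    · simp [mul_y, one_y]
  mul_one g := by
    ext
    · simp [mul_x, one_x, Matrix.mulVec_zero]
    · simp [mul_y, one_y]
  inv_mul_cancel g := by
    ext
    · simp [mul_x, inv_x, inv_y, one_x]
    · simp [mul_y, inv_y, one_y]

end Gamma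

/-- `d' = dim_ℚ ker(A − I : ℚⁿ → ℚⁿ)`. -/
noncomputable def dPrime {n : ℕ} (A : (Matrix (Fin n) (Fin n) ℤ)ˣ) : ℕ :=
  Module.finrank ℚ
    (LinearMap.ker
      (Matrix.mulVecLin ((A : Matrix (Fin n) (Fin n) ℤ).map (Int.cast : ℤ → ℚ) - 1)))

/-- The image of `A - 1` acting on `ℤⁿ`. -/
def coboundaries {n : ℕ} (A : (Matrix (Fin n) (Fin n) ℤ)ˣ) : Submodule ℤ (Fin n → ℤ) :=
  LinearMap.range (Matrix.mulVecLin ((A : Matrix (Fin n) (Fin n) ℤ) - 1))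

theorem mk_zpow_mulVec {n : ℕ} (A : (Matrix (Fin n) (Fin n) ℤ)ˣ) (k : ℤ) (v : Fin n → ℤ) :
    (coboundaries A).mkQ
        (((A ^ k : (Matrix (Fin n) (Fin n) ℤ)ˣ) : Matrix (Fin n) (Fin n) ℤ).mulVec v) =
      (coboundaries A).mkQ v := by
  let S : Subgroup (Matrix (Fin n) (Fin n) ℤ)ˣ :=
    { carrier := {U | ∀ v, (coboundaries A).mkQ ((U : Matrix (Fin n) (Fin n) ℤ).mulVec v) =
        (coboundaries A).mkQ v}
      one_mem' := fun v => by rw [Units.val_one, Matrix.one_mulVec]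
      mul_mem' := fun {U V} hU hV v => by
        rw [Units.val_mul, ← Matrix.mulVec_mulVec, hU, hV]
      inv_mem' := fun {U} hU v => by
        rw [← hU, Matrix.mulVec_mulVec, Units.mul_inv, Matrix.one_mulVec] }
  have hA : A ∈ S := fun v => by
    rw [← sub_eq_zero, ← map_sub, Submodule.mkQ_apply, Submodule.Quotient.mk_eq_zero]
    exact ⟨v, by simp⟩
  exact S.zpow_mem hA k v

/-- The projection of `Γ_A` onto `ℤⁿ / (A - 1) ℤⁿ × ℤ`. -/
def Gamma.toCoinvariants {n : ℕ} (A : (Matrix (Fin n) (Fin n) ℤ)ˣ) :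
    Gamma n A →* Multiplicative (((Fin n → ℤ) ⧸ coboundaries A) × ℤ) where
  toFun g := Multiplicative.ofAdd ((coboundaries A).mkQ g.x, g.y)
  map_one' := by
    rw [Gamma.one_x, Gamma.one_y, map_zero]
    rfl
  map_mul' g h := by
    rw [Gamma.mul_x, Gamma.mul_y, map_add, mk_zpow_mulVec]
    rfl

theorem Gamma.toCoinvariants_surjective {n : ℕ} (A : (Matrix (Fin n) (Fin n) ℤ)ˣ) :
    Function.Surjective (Gamma.toCoinvariants A) := by
  intro q
  obtain ⟨v, hv⟩ := (coboundaries A).mkQ_surjective q.toAdd.1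
  exact ⟨⟨v, q.toAdd.2⟩, congrArg Multiplicative.ofAdd (Prod.ext hv rfl)⟩

open scoped commutatorElement in
theorem Gamma.ker_toCoinvariants {n : ℕ} (A : (Matrix (Fin n) (Fin n) ℤ)ˣ) :
    (Gamma.toCoinvariants A).ker = commutator (Gamma n A) := by
  refine le_antisymm (fun g hg => ?_) (Abelianization.commutator_subset_ker _)
  have h := congrArg Multiplicative.toAdd (MonoidHom.mem_ker.mp hg)
  have hx : (coboundaries A).mkQ g.x = 0 := congrArg Prod.fst h
  have hy : g.y = 0 := congrArg Prod.snd h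
  rw [Submodule.mkQ_apply, Submodule.Quotient.mk_eq_zero] at hx
  obtain ⟨w, hw⟩ := hx
  have hg : g = ⁅(⟨0, 1⟩ : Gamma n A), ⟨w, 0⟩⁆ := by
    ext1
    · simp [commutatorElement_def, Gamma.mul_x, Gamma.mul_y, Gamma.inv_x, Gamma.inv_y, ← hw,
        sub_eq_add_neg, Matrix.mulVec_neg]
    · simp [commutatorElement_def, Gamma.mul_y, Gamma.inv_y, hy]
  rw [hg]
  exact Subgroup.commutator_mem_commutator (Subgroup.mem_top _) (Subgroup.mem_top _)

/-- The abelianization of `Γ_A` is `ℤⁿ / (A - 1) ℤⁿ × ℤ`. -/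
noncomputable def Gamma.abelianizationEquiv {n : ℕ} (A : (Matrix (Fin n) (Fin n) ℤ)ˣ) :
    Abelianization (Gamma n A) ≃* Multiplicative (((Fin n → ℤ) ⧸ coboundaries A) × ℤ) :=
  (QuotientGroup.quotientMulEquivOfEq (Gamma.ker_toCoinvariants A).symm).trans
    (QuotientGroup.quotientKerEquivOfSurjective _ (Gamma.toCoinvariants_surjective A))

/-- The kernels of an integer matrix over `ℤ` and over `ℚ` have the same rank. -/
theorem finrank_ker_mulVecLin_map_intCast {m n : ℕ} (B : Matrix (Fin m) (Fin n) ℤ) :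
    Module.finrank ℚ (LinearMap.ker (B.map (Int.cast : ℤ → ℚ)).mulVecLin) =
      Module.finrank ℤ (LinearMap.ker B.mulVecLin) := by
  have hcast (v : Fin n → ℤ) :
      (B.map (Int.cast : ℤ → ℚ)).mulVec (fun i => (v i : ℚ)) = fun i => (B.mulVec v i : ℚ) := by
    ext i
    simp [Matrix.mulVec, dotProduct]
  have hcast_mem (v : Fin n → ℤ) : (fun i => (v i : ℚ)) ∈
      LinearMap.ker (B.map (Int.cast : ℤ → ℚ)).mulVecLin ↔ v ∈ LinearMap.ker B.mulVecLin := by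
    simp only [LinearMap.mem_ker, Matrix.mulVecLin_apply, hcast, funext_iff, Pi.zero_apply,
      Int.cast_eq_zero]
  let f : LinearMap.ker B.mulVecLin →ₗ[ℤ]
      LinearMap.ker (B.map (Int.cast : ℤ → ℚ)).mulVecLin :=
    { toFun := fun v => ⟨fun i => (v.1 i : ℚ), (hcast_mem v.1).mpr v.2⟩
      map_add' := fun v w => by ext i; simp
      map_smul' := fun c v => by ext i; simp }
  have hf : IsLocalizedModule (nonZeroDivisors ℤ) f :=
    { map_units := fun c => by
        have hc : (c.1 : ℚ) ≠ 0 := Int.cast_ne_zero.mpr (nonZeroDivisors.ne_zero c.2)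
        rw [Module.End.isUnit_iff]
        refine ⟨fun v w h => ?_, fun v => ⟨(c.1 : ℚ)⁻¹ • v, ?_⟩⟩
        · have h : c.1 • v = c.1 • w := h
          exact smul_right_injective _ (nonZeroDivisors.ne_zero c.2) h
        · change c.1 • ((c.1 : ℚ)⁻¹ • v) = v
          rw [← Int.cast_smul_eq_zsmul ℚ, smul_inv_smul₀ hc]
      surj := fun v => by
        obtain ⟨c, hc⟩ := IsLocalization.exist_integer_multiples_of_finite
          (nonZeroDivisors ℤ) (fun i => v.1 i)
        choose w hw using hc
        have hwv : (fun i => (w i : ℚ)) = (c.1 • v).1 := funext fun i => by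
          simpa using hw i
        exact ⟨(⟨w, (hcast_mem w).mp (hwv ▸ (c.1 • v).2)⟩, c), Subtype.ext hwv.symm⟩
      exists_of_eq := fun {v w} h => ⟨1, by
        congr 1
        ext i
        exact Int.cast_injective (congrFun (congrArg Subtype.val h) i)⟩ }
  rw [IsFractionRing.finrank_right_eq ℤ ℚ,
    IsLocalizedModule.finrank_eq (nonZeroDivisors ℤ) f le_rfl]

theorem finrank_quotient_coboundaries {n : ℕ} (A : (Matrix (Fin n) (Fin n) ℤ)ˣ) :
    Module.finrank ℤ ((Fin n → ℤ) ⧸ coboundaries A) = dPrime A := by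
  have hB : (A : Matrix (Fin n) (Fin n) ℤ).map (Int.cast : ℤ → ℚ) - 1 =
      ((A : Matrix (Fin n) (Fin n) ℤ) - 1).map (Int.cast : ℤ → ℚ) := by
    ext i j
    simp [Matrix.one_apply]
  rw [dPrime, hB, finrank_ker_mulVecLin_map_intCast]
  have h₁ := (coboundaries A).finrank_quotient_add_finrank
  have h₂ := (LinearMap.ker
    (Matrix.mulVecLin ((A : Matrix (Fin n) (Fin n) ℤ) - 1))).finrank_quotient_add_finrank
  rw [(LinearMap.quotKerEquivRange _).finrank_eq] at h₂
  rw [coboundaries] at *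
  omega

/-- A finitely generated abelian group is the product of a free group of the same rank and a
finite group. -/
theorem exists_addEquiv_free_prod_finite (M : Type) [AddCommGroup M] [Module.Finite ℤ M] :
    ∃ (T : Type) (_ : AddCommGroup T) (_ : Finite T),
      Nonempty (M ≃+ (Fin (Module.finrank ℤ M) → ℤ) × T) := by
  obtain ⟨k, ι, _, p, hp, e, ⟨φ⟩⟩ :=
    @AddCommGroup.equiv_free_prod_directSum_zmod M _ (Module.Finite.iff_addGroup_fg.mp ‹_›)
  have (i : ι) : NeZero (p i ^ e i) := ⟨pow_ne_zero _ (hp i).ne_zero⟩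
  let T := DirectSum ι fun i => ZMod (p i ^ e i)
  have hT : Finite T := Finite.of_equiv _ DFinsupp.equivFunOnFintype.symm
  let π : M →ₗ[ℤ] (Fin k →₀ ℤ) := LinearMap.fst ℤ _ T ∘ₗ φ.toIntLinearEquiv.toLinearMap
  have hπ : Function.Surjective π := Prod.fst_surjective.comp φ.surjective
  have hker : Finite (LinearMap.ker π) :=
    Finite.of_injective (fun v => (φ v.1).2) fun v w h =>
      Subtype.ext (φ.injective (Prod.ext (v.2.trans w.2.symm) h))
  have hker0 : Module.finrank ℤ (LinearMap.ker π) = 0 := by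
    rw [Module.finrank_eq_zero_iff]
    intro v
    exact ⟨addOrderOf v, Int.natCast_ne_zero.mpr (addOrderOf_pos v).ne',
      by rw [natCast_zsmul, addOrderOf_nsmul_eq_zero]⟩
  have hk : Module.finrank ℤ M = k := by
    have h := (LinearMap.ker π).finrank_quotient_add_finrank
    rw [(π.quotKerEquivOfSurjective hπ).finrank_eq, hker0] at h
    simpa using h.symm
  rw [hk]
  exact ⟨T, inferInstance, hT, ⟨φ.trans
    ((Finsupp.linearEquivFunOnFinite ℤ ℤ (Fin k)).toAddEquiv.prodCongr (AddEquiv.refl T))⟩⟩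

/-- There is a finite abelian group `H` such that the abelianization of `Γ_A` is isomorphic
to `ℤ^{1+d'} × H`; geometrically, the first Betti number of the torus bundle over `S¹`
obtained by suspension of `A` is `1 + dim ker (A − I)`. -/
theorem stmt5 {n : ℕ} (hn : 1 ≤ n) (A : (Matrix (Fin n) (Fin n) ℤ)ˣ) :
    ∃ (H : Type) (_ : CommGroup H) (_ : Finite H),
      Nonempty (Abelianization (Gamma n A) ≃*
        (Multiplicative (Fin (1 + dPrime A) → ℤ) × H)) := by
  obtain ⟨T, _, _, ⟨φ⟩⟩ := exists_addEquiv_free_prod_finite ((Fin n → ℤ) ⧸ coboundaries A)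
  rw [finrank_quotient_coboundaries] at φ
  let ψ : (((Fin n → ℤ) ⧸ coboundaries A) × ℤ) ≃+ (Fin (1 + dPrime A) → ℤ) × T :=
    (φ.prodCongr (AddEquiv.refl ℤ)).trans <| AddEquiv.prodComm.trans <|
      AddEquiv.prodAssoc.symm.trans <| AddEquiv.prodCongr
        (((LinearEquiv.funUnique (Fin 1) ℤ ℤ).symm.toAddEquiv.prodCongr
            (AddEquiv.refl (Fin (dPrime A) → ℤ))).trans
          ((LinearEquiv.sumArrowLequivProdArrow (Fin 1) (Fin (dPrime A)) ℤ ℤ).symm.trans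
            (LinearEquiv.funCongrLeft ℤ ℤ finSumFinEquiv.symm)).toAddEquiv)
        (AddEquiv.refl T)
  exact ⟨Multiplicative T, inferInstance, inferInstanceAs (Finite T),
    ⟨(Gamma.abelianizationEquiv A).trans <| (AddEquiv.toMultiplicative ψ).trans
      (MulEquiv.prodMultiplicative _ _)⟩⟩
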